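/- The infinite series identity $\sum_{k=0}^{\infty}\Big(\frac{16}{27}\Big)^k\frac{((1)_k)^2}{(7/6)_k\,(11/6)_k}\Big\{\frac{21+22k}{1+2k}H_{1+2k}^{(2)}-\frac{145+174k}{(1+2k)^3}\Big\} = -120\beta(4)$ holds. -/

import Mathlib

open scoped BigOperators

/-- The shifted factorial (Pochhammer symbol) `(x)_n = x (x+1) ⋯ (x+n-1)`. -/
noncomputable def poch (x : ℝ) (n : ℕ) : ℝ := ∏ i ∈ Finset.range n, (x + i)

/-- The harmonic numbers of order 2, `H_n^{(2)} = ∑_{j=1}^n 1/j²`. -/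
noncomputable def H2 (n : ℕ) : ℝ := ∑ j ∈ Finset.range n, 1 / ((j : ℝ) + 1) ^ 2

/-- The Dirichlet beta value `β(4) = ∑_{k≥0} (-1)^k/(1+2k)⁴`. -/
noncomputable def beta4 : ℝ := ∑' k : ℕ, (-1) ^ k / (1 + 2 * (k : ℝ)) ^ 4

/-- The Catalan constant `G = ∑_{k≥0} (-1)^k/(1+2k)²`. -/
noncomputable def catalanG : ℝ := ∑' k : ℕ, (-1) ^ k / (1 + 2 * (k : ℝ)) ^ 2

lemma natCast_ne_add_half (N k : ℕ) : (N : ℝ) - (k + 1 / 2) ≠ 0 := by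
  intro h
  have h2 : (2 * N : ℝ) = 2 * k + 1 := by linarith
  have h3 : 2 * N = 2 * k + 1 := by exact_mod_cast h2
  omega

lemma succ_sub_half_ne (N k : ℕ) : (N : ℝ) + 1 - (k + 1 / 2) ≠ 0 := by
  exact_mod_cast natCast_ne_add_half (N + 1) k

lemma half_le_abs_succ_sub_half (N k : ℕ) : 1 / 2 ≤ |(N : ℝ) + 1 - (k + 1 / 2)| := by
  rcases Nat.lt_or_ge N k with h | h
  · have : (N : ℝ) + 1 ≤ k := by exact_mod_cast h
    rw [abs_of_neg (by linarith)]
    linarith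
  · have : (k : ℝ) ≤ N := by exact_mod_cast h
    rw [abs_of_nonneg (by linarith)]
    linarith

lemma H2_succ (n : ℕ) : H2 (n + 1) = H2 n + 1 / ((n : ℝ) + 1) ^ 2 := by
  simp [H2, Finset.sum_range_succ]

lemma H2_nonneg (n : ℕ) : 0 ≤ H2 n := Finset.sum_nonneg fun _ _ => by positivity

lemma H2_le (n : ℕ) : H2 n ≤ n := by
  induction n with
  | zero => simp [H2]
  | succ n ih =>
    have h : 1 / ((n : ℝ) + 1) ^ 2 ≤ 1 := by
      rw [div_le_one (by positivity)]
      exact one_le_pow₀ (by linarith [n.cast_nonneg (α := ℝ)])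
    rw [H2_succ]
    push_cast
    linarith

/-- The product `∏_{j=1}^N j² / (j² - m²)` at the half-integer `m = k + 1/2`. -/
noncomputable def ratioProd (N k : ℕ) : ℝ :=
  ∏ j ∈ Finset.range N, ((j : ℝ) + 1) ^ 2 / (((j : ℝ) + 1) ^ 2 - (k + 1 / 2) ^ 2)

/-- The coefficient of `x²` in `∏_{j=1}^N (j² - x²) / (j² - m²) / (m² - x²)`, `m = k + 1/2`. -/
noncomputable def kernelTerm (N k : ℕ) : ℝ :=
  ratioProd N k / ((k : ℝ) + 1 / 2) ^ 2 * (1 / ((k : ℝ) + 1 / 2) ^ 2 - H2 N)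

/-- The alternating antidifference in `k` of `ratioProd N k / ((N + 1)² - (k + 1/2)²)`. -/
noncomputable def antidiff (N k : ℕ) : ℝ :=
  ratioProd N k / (2 * ((k : ℝ) + 1 / 2) * ((N : ℝ) + 1 - (k + 1 / 2)))

/-- The alternating tail sum of `kernelTerm N` starting at `M`. -/
noncomputable def tailSum (N M : ℕ) : ℝ := ∑' k : ℕ, (-1) ^ k * kernelTerm N (M + k)

lemma ratioProd_succ (N k : ℕ) : ratioProd (N + 1) k =
    ratioProd N k * (((N : ℝ) + 1) ^ 2 /
      (((N : ℝ) + 1 - (k + 1 / 2)) * ((N : ℝ) + 1 + (k + 1 / 2)))) := by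
  rw [ratioProd, Finset.prod_range_succ, ← ratioProd]
  congr 2
  ring

lemma ratioProd_succ_right (N k : ℕ) : ratioProd N (k + 1) =
    ratioProd N k * (((k : ℝ) + 1 / 2 - N) * (k + 3 / 2) /
      ((k + 1 / 2) * (k + N + 3 / 2))) := by
  have hk : (0 : ℝ) ≤ k := k.cast_nonneg
  induction N with
  | zero =>
    simp only [ratioProd, Finset.range_zero, Finset.prod_empty, Nat.cast_zero]
    field_simp
    ring
  | succ N ih =>
    have h1 := succ_sub_half_ne N k
    have h2 := succ_sub_half_ne N (k + 1)
    have hN : (0 : ℝ) ≤ N := N.cast_nonneg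
    have h3 : (N : ℝ) + 1 + (k + 1 / 2) ≠ 0 := by positivity
    have h4 : (N : ℝ) + 1 + (k + 1 + 1 / 2) ≠ 0 := by positivity
    have h5 : (k : ℝ) + N + 3 / 2 ≠ 0 := by positivity
    have h6 : (k : ℝ) + (N + 1) + 3 / 2 ≠ 0 := by positivity
    have h7 : (k : ℝ) + 1 / 2 ≠ 0 := by positivity
    rw [ratioProd_succ, ratioProd_succ, ih]
    push_cast at h2 ⊢
    rw [mul_assoc, mul_assoc]
    congr 1
    rw [div_mul_div_comm, div_mul_div_comm, div_eq_div_iff (by positivity) (by positivity)]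
    ring

lemma abs_ratioProd_le (N k : ℕ) :
    |ratioProd N k| ≤ ∏ j ∈ Finset.range N, 2 * ((j : ℝ) + 1) := by
  rw [ratioProd, Finset.abs_prod]
  refine Finset.prod_le_prod (fun _ _ => abs_nonneg _) fun j _ => ?_
  have h := half_le_abs_succ_sub_half j k
  have hk : (0 : ℝ) ≤ k := k.cast_nonneg
  have hj : (0 : ℝ) ≤ j := j.cast_nonneg
  have e : ((j : ℝ) + 1) ^ 2 - (k + 1 / 2) ^ 2 =
      ((j : ℝ) + 1 - (k + 1 / 2)) * (j + 1 + (k + 1 / 2)) := by ring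
  have hpos : (0 : ℝ) < j + 1 + (k + 1 / 2) := by positivity
  rw [e, abs_div, abs_mul, abs_of_pos hpos, abs_of_nonneg (by positivity : (0 : ℝ) ≤ (j + 1) ^ 2),
    div_le_iff₀ (by positivity)]
  have h2 : 1 / 2 * ((j : ℝ) + 1) ≤
      |(j : ℝ) + 1 - (k + 1 / 2)| * (j + 1 + (k + 1 / 2)) :=
    mul_le_mul h (by linarith) (by positivity) (by positivity)
  nlinarith

lemma kernelTerm_succ (N k : ℕ) : kernelTerm (N + 1) k =
    kernelTerm N k - H2 N * (antidiff N k + antidiff N (k + 1)) := by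
  have h1 := succ_sub_half_ne N k
  have h2 : (N : ℝ) - (k + 1 / 2) ≠ 0 := natCast_ne_add_half N k
  have h2' : (N : ℝ) + 1 - ((k + 1 : ℕ) + 1 / 2) = N - (k + 1 / 2) := by push_cast; ring
  have hN : (0 : ℝ) ≤ N := N.cast_nonneg
  have hk : (0 : ℝ) ≤ k := k.cast_nonneg
  have h3 : (N : ℝ) + 1 + (k + 1 / 2) ≠ 0 := by positivity
  have h7 : (k : ℝ) + 1 / 2 ≠ 0 := by positivity
  have h8 : (k : ℝ) + 3 / 2 ≠ 0 := by positivity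
  have h9 : (N : ℝ) + 1 ≠ 0 := by positivity
  have e : antidiff N (k + 1) =
      - (ratioProd N k / (2 * (k + 1 / 2) * ((N : ℝ) + 1 + (k + 1 / 2)))) := by
    have h5 : (k : ℝ) + N + 3 / 2 = N + 1 + (k + 1 / 2) := by ring
    have h6 : ((k + 1 : ℕ) : ℝ) + 1 / 2 = k + 3 / 2 := by push_cast; ring
    have h10 : (k : ℝ) + 1 / 2 - N = - (N - (k + 1 / 2)) := by ring
    rw [antidiff, ratioProd_succ_right, h2', h5, h6, h10]
    generalize (N : ℝ) - (k + 1 / 2) = a at *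
    generalize (N : ℝ) + 1 + (k + 1 / 2) = b at *
    generalize (k : ℝ) + 3 / 2 = c at *
    generalize (k : ℝ) + 1 / 2 = d at *
    field_simp
  rw [e, kernelTerm, kernelTerm, antidiff, ratioProd_succ, H2_succ]
  generalize (k : ℝ) + 1 / 2 = m at *
  generalize (N : ℝ) + 1 = a at *
  field_simp
  ring

lemma summable_inv_add_half_sq : Summable fun k : ℕ => 1 / ((k : ℝ) + 1 / 2) ^ 2 := by
  have h := (summable_nat_add_iff 1).2 (Real.summable_one_div_nat_pow.2 (by norm_num : 1 < 2))
  refine Summable.of_nonneg_of_le (fun _ => by positivity) (fun k => ?_) (h.mul_left 4)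
  have hk : (0 : ℝ) ≤ k := k.cast_nonneg
  push_cast
  rw [mul_one_div, div_le_div_iff₀ (by positivity) (by positivity)]
  nlinarith

lemma abs_kernelTerm_le {B : ℝ} (N M k : ℕ) (h : |ratioProd N (M + k)| ≤ B) :
    |kernelTerm N (M + k)| ≤ B * (4 + N) * (1 / ((k : ℝ) + 1 / 2) ^ 2) := by
  have hk : (0 : ℝ) ≤ k := k.cast_nonneg
  have hM : (0 : ℝ) ≤ M := M.cast_nonneg
  have hm : ((k : ℝ) + 1 / 2) ^ 2 ≤ (((M + k : ℕ) : ℝ) + 1 / 2) ^ 2 := by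
    push_cast
    gcongr
    linarith
  have hq : 1 / (((M + k : ℕ) : ℝ) + 1 / 2) ^ 2 ≤ 1 / ((k : ℝ) + 1 / 2) ^ 2 :=
    one_div_le_one_div_of_le (by positivity) hm
  have h4 : 1 / (((M + k : ℕ) : ℝ) + 1 / 2) ^ 2 ≤ 4 := by
    refine hq.trans ?_
    rw [div_le_iff₀ (by positivity)]
    nlinarith
  have h5 : 0 ≤ 1 / (((M + k : ℕ) : ℝ) + 1 / 2) ^ 2 := by positivity
  have h6 : |1 / (((M + k : ℕ) : ℝ) + 1 / 2) ^ 2 - H2 N| ≤ 4 + (N : ℝ) := by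
    rw [abs_le]
    constructor <;> linarith [H2_le N, H2_nonneg N]
  have hB : 0 ≤ B := (abs_nonneg _).trans h
  rw [kernelTerm, div_eq_mul_one_div (ratioProd _ _), abs_mul, abs_mul, abs_of_nonneg h5]
  calc |ratioProd N (M + k)| * (1 / (((M + k : ℕ) : ℝ) + 1 / 2) ^ 2) * _
      ≤ B * (1 / ((k : ℝ) + 1 / 2) ^ 2) * (4 + N) := by gcongr
    _ = _ := by ring

lemma summable_kernelTerm (N M : ℕ) :
    Summable fun k : ℕ => (-1 : ℝ) ^ k * kernelTerm N (M + k) := by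
  refine Summable.of_norm_bounded (summable_inv_add_half_sq.mul_left
    ((∏ j ∈ Finset.range N, 2 * ((j : ℝ) + 1)) * (4 + N))) fun k => ?_
  rw [Real.norm_eq_abs, abs_mul, abs_pow, abs_neg, abs_one, one_pow, one_mul]
  exact abs_kernelTerm_le N M k (abs_ratioProd_le N (M + k))

lemma tailSum_eq_sub (N M : ℕ) : tailSum N M = kernelTerm N M - tailSum N (M + 1) := by
  rw [tailSum, (summable_kernelTerm N M).tsum_eq_zero_add, tailSum, sub_eq_add_neg, ← tsum_neg]
  congr 1
  · simp
  · refine tsum_congr fun k => ?_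
    rw [show M + (k + 1) = M + 1 + k by ring]
    ring

lemma tendsto_antidiff (N M : ℕ) :
    Filter.Tendsto (fun k : ℕ => antidiff N (M + k)) Filter.atTop (nhds 0) := by
  have h0 : Filter.Tendsto (fun k : ℕ =>
      (∏ j ∈ Finset.range N, 2 * ((j : ℝ) + 1)) * (1 / ((k : ℝ) + 1)) * 2)
      Filter.atTop (nhds 0) := by
    simpa using ((tendsto_one_div_add_atTop_nhds_zero_nat (𝕜 := ℝ)).const_mul
      (∏ j ∈ Finset.range N, 2 * ((j : ℝ) + 1))).mul_const 2
  refine squeeze_zero_norm (fun k => ?_) h0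
  have hk : (0 : ℝ) ≤ k := k.cast_nonneg
  have hM : (0 : ℝ) ≤ M := M.cast_nonneg
  have h1 := half_le_abs_succ_sub_half N (M + k)
  have hB := abs_ratioProd_le N (M + k)
  have hB0 := (abs_nonneg _).trans hB
  have hm : (0 : ℝ) < 2 * (((M + k : ℕ) : ℝ) + 1 / 2) := by positivity
  rw [Real.norm_eq_abs, antidiff, abs_div, abs_mul, abs_of_pos hm, mul_one_div,
    div_mul_eq_mul_div, div_le_div_iff₀ (by positivity) (by positivity)]
  have h2 : ((k : ℝ) + 1) * (1 / 2) ≤ 2 * (((M + k : ℕ) : ℝ) + 1 / 2) *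
      |(N : ℝ) + 1 - (((M + k : ℕ) : ℝ) + 1 / 2)| := by
    refine mul_le_mul ?_ h1 (by positivity) (by positivity)
    push_cast
    linarith
  calc |ratioProd N (M + k)| * ((k : ℝ) + 1)
      ≤ (∏ j ∈ Finset.range N, 2 * ((j : ℝ) + 1)) * 2 * ((k + 1) * (1 / 2)) := by
        rw [show (∏ j ∈ Finset.range N, 2 * ((j : ℝ) + 1)) * 2 * (((k : ℝ) + 1) * (1 / 2)) =
          (∏ j ∈ Finset.range N, 2 * ((j : ℝ) + 1)) * (k + 1) by ring]
        gcongr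
    _ ≤ _ := by gcongr

lemma tailSum_succ (N M : ℕ) : tailSum (N + 1) M = tailSum N M - H2 N * antidiff N M := by
  have hs := (summable_kernelTerm N M).sub (summable_kernelTerm (N + 1) M)
  have hterm : ∀ k : ℕ, (-1 : ℝ) ^ k * kernelTerm N (M + k) -
      (-1) ^ k * kernelTerm (N + 1) (M + k) =
      H2 N * ((-1) ^ k * antidiff N (M + k)) -
        H2 N * ((-1) ^ (k + 1) * antidiff N (M + (k + 1))) := by
    intro k
    rw [kernelTerm_succ, ← add_assoc]
    ring
  have hlim : Filter.Tendsto (fun k : ℕ => H2 N * ((-1) ^ k * antidiff N (M + k)))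
      Filter.atTop (nhds 0) := by
    have : Filter.Tendsto (fun k : ℕ => (-1 : ℝ) ^ k * antidiff N (M + k))
        Filter.atTop (nhds 0) := by
      refine squeeze_zero_norm (fun k => ?_)
        (tendsto_zero_iff_norm_tendsto_zero.1 (tendsto_antidiff N M))
      simp
    simpa using this.const_mul (H2 N)
  have hsum : ∑' k : ℕ, ((-1 : ℝ) ^ k * kernelTerm N (M + k) -
      (-1) ^ k * kernelTerm (N + 1) (M + k)) = H2 N * antidiff N M := by
    refine tendsto_nhds_unique hs.hasSum.tendsto_sum_nat ?_
    simp_rw [hterm, Finset.sum_range_sub']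
    simpa using hlim.const_sub (H2 N * antidiff N M)
  rw [(summable_kernelTerm N M).tsum_sub (summable_kernelTerm (N + 1) M)] at hsum
  rw [tailSum, tailSum]
  linarith

/-- The hypergeometric factor of the series. -/
noncomputable def weight (k : ℕ) : ℝ :=
  (16 / 27 : ℝ) ^ k * (poch 1 k ^ 2 / (poch (7 / 6) k * poch (11 / 6) k))

lemma poch_pos {x : ℝ} (hx : 0 < x) (n : ℕ) : 0 < poch x n :=
  Finset.prod_pos fun _ _ => by positivity

lemma weight_nonneg (k : ℕ) : 0 ≤ weight k := by
  have h1 := poch_pos (x := 7 / 6) (by norm_num) k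
  have h2 := poch_pos (x := 11 / 6) (by norm_num) k
  unfold weight
  positivity

lemma weight_succ (k : ℕ) : weight (k + 1) =
    weight k * (16 / 27 * ((k + 1 : ℝ) ^ 2 / ((k + 7 / 6) * (k + 11 / 6)))) := by
  have h1 := (poch_pos (x := 7 / 6) (by norm_num) k).ne'
  have h2 := (poch_pos (x := 11 / 6) (by norm_num) k).ne'
  have e : ∀ x : ℝ, poch x (k + 1) = poch x k * (k + x) := fun x => by
    rw [poch, Finset.prod_range_succ, ← poch, add_comm x]
  rw [weight, weight, e, e, e, pow_succ]
  field_simp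

lemma weight_le (k : ℕ) : weight k ≤ (16 / 27) ^ k := by
  induction k with
  | zero => simp [weight, poch]
  | succ k ih =>
    rw [weight_succ, pow_succ (16 / 27 : ℝ)]
    have hk : (0 : ℝ) ≤ k := k.cast_nonneg
    have h : (k + 1 : ℝ) ^ 2 / ((k + 7 / 6) * (k + 11 / 6)) ≤ 1 := by
      rw [div_le_one (by positivity)]
      nlinarith
    exact mul_le_mul ih (by linarith) (by positivity) (by positivity)

lemma ratioProd_diag (n : ℕ) : (-1) ^ n * ratioProd (2 * n) n =
    (2 * n + 1) * (6 * n + 5) / 5 * weight n := by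
  induction n with
  | zero => simp [ratioProd, weight, poch]
  | succ n ih =>
    have hn : (0 : ℝ) ≤ n := n.cast_nonneg
    have e : (-1) ^ (n + 1) * ratioProd (2 * (n + 1)) (n + 1) =
        ((-1) ^ n * ratioProd (2 * n) n) * (16 * (n + 1) ^ 2 * (n + 3 / 2) /
          ((3 * n + 3 / 2) * (3 * n + 5 / 2) * (3 * n + 7 / 2))) := by
      have a1 : (2 * n : ℝ) + 1 - (n + 1 / 2) = n + 1 / 2 := by ring
      have a2 : (2 * n : ℝ) + 1 + 1 - (n + 1 / 2) = n + 3 / 2 := by ring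
      have a3 : (2 * n : ℝ) + 1 + (n + 1 / 2) = 3 * n + 3 / 2 := by ring
      have a4 : (2 * n : ℝ) + 1 + 1 + (n + 1 / 2) = 3 * n + 5 / 2 := by ring
      have a5 : (n : ℝ) + 1 / 2 - (2 * n + 1 + 1) = - (n + 3 / 2) := by ring
      have a6 : (n : ℝ) + (2 * n + 1 + 1) + 3 / 2 = 3 * n + 7 / 2 := by ring
      rw [show 2 * (n + 1) = 2 * n + 1 + 1 by ring, ratioProd_succ_right, ratioProd_succ,
        ratioProd_succ]
      push_cast
      rw [a1, a2, a3, a4, a5, a6]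
      field_simp
      ring
    rw [e, ih, weight_succ]
    push_cast
    field_simp
    ring

lemma abs_ratioProd_diag_add_le (n k : ℕ) :
    |ratioProd (2 * n) (n + k)| ≤ (2 * n + 1) * (6 * n + 5) / 5 * (16 / 27) ^ n := by
  have hn : (0 : ℝ) ≤ n := n.cast_nonneg
  induction k with
  | zero =>
    have h : |ratioProd (2 * n) n| = (2 * n + 1) * (6 * n + 5) / 5 * weight n := by
      rw [← abs_of_nonneg (a := (2 * n + 1) * (6 * n + 5) / 5 * weight n)
        (mul_nonneg (by positivity) (weight_nonneg n)), ← ratioProd_diag]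
      simp [abs_mul]
    rw [add_zero, h]
    gcongr
    exact weight_le n
  | succ k ih =>
    have hk : (0 : ℝ) ≤ k := k.cast_nonneg
    refine le_trans ?_ ih
    rw [← add_assoc, ratioProd_succ_right, abs_mul]
    refine mul_le_of_le_one_right (abs_nonneg _) ?_
    push_cast
    rw [abs_le, div_le_one (by positivity), le_div_iff₀ (by positivity)]
    constructor <;> nlinarith [mul_nonneg hn hk]

lemma tendsto_tailSum_diag :
    Filter.Tendsto (fun n : ℕ => (-1) ^ n * tailSum (2 * n) n) Filter.atTop (nhds 0) := by
  set C : ℝ := ∑' k : ℕ, 1 / ((k : ℝ) + 1 / 2) ^ 2 with hC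
  have hlim : Filter.Tendsto (fun n : ℕ =>
      (2 * (n : ℝ) + 1) * (6 * n + 5) / 5 * (16 / 27) ^ n * (4 + 2 * n) * C)
      Filter.atTop (nhds 0) := by
    have hp : ∀ j : ℕ, Filter.Tendsto (fun n : ℕ => (n : ℝ) ^ j * (16 / 27 : ℝ) ^ n)
        Filter.atTop (nhds 0) := fun j =>
      tendsto_pow_const_mul_const_pow_of_lt_one j (by norm_num) (by norm_num)
    have h := (((((hp 3).const_mul (24 / 5)).add ((hp 2).const_mul (80 / 5))).add
      ((hp 1).const_mul (74 / 5))).add ((hp 0).const_mul (20 / 5))).mul_const C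
    simp only [mul_zero, add_zero, zero_mul] at h
    refine h.congr fun n => ?_
    ring
  refine squeeze_zero_norm (fun n => ?_) hlim
  rw [norm_mul, norm_pow, norm_neg, norm_one, one_pow, one_mul, tailSum, hC, ← tsum_mul_left]
  refine tsum_of_norm_bounded (summable_inv_add_half_sq.mul_left _).hasSum fun k => ?_
  rw [Real.norm_eq_abs, abs_mul, abs_pow, abs_neg, abs_one, one_pow, one_mul]
  exact_mod_cast abs_kernelTerm_le (2 * n) n k (abs_ratioProd_diag_add_le n k)

lemma tailSum_zero_zero : tailSum 0 0 = 16 * beta4 := by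
  rw [tailSum, beta4, ← tsum_mul_left]
  refine tsum_congr fun k => ?_
  have hk : (0 : ℝ) ≤ k := k.cast_nonneg
  simp only [kernelTerm, ratioProd, H2, Finset.range_zero, Finset.prod_empty, Finset.sum_empty,
    zero_add, sub_zero]
  rw [show (k : ℝ) + 1 / 2 = (1 + 2 * k) / 2 by ring]
  field_simp
  norm_num

/-- The summand of the series. -/
noncomputable def summand (k : ℕ) : ℝ :=
  weight k * ((21 + 22 * (k : ℝ)) / (1 + 2 * (k : ℝ)) * H2 (1 + 2 * k) -
    (145 + 174 * (k : ℝ)) / (1 + 2 * (k : ℝ)) ^ 3)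

lemma summand_eq_sub (n : ℕ) : summand n =
    15 / 2 * ((-1) ^ (n + 1) * tailSum (2 * (n + 1)) (n + 1)) -
      15 / 2 * ((-1) ^ n * tailSum (2 * n) n) := by
  have hn : (0 : ℝ) ≤ n := n.cast_nonneg
  have h1 := tailSum_eq_sub (2 * n + 1 + 1) n
  have h2 := tailSum_succ (2 * n + 1) n
  have h3 := tailSum_succ (2 * n) n
  have h4 : tailSum (2 * n + 1 + 1) (n + 1) = kernelTerm (2 * n + 1 + 1) n - tailSum (2 * n) n +
      H2 (2 * n) * antidiff (2 * n) n + H2 (2 * n + 1) * antidiff (2 * n + 1) n := by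
    linarith
  have a1 : (2 * n : ℝ) + 1 - (n + 1 / 2) = n + 1 / 2 := by ring
  have a2 : (2 * n : ℝ) + 1 + 1 - (n + 1 / 2) = n + 3 / 2 := by ring
  have a3 : (2 * n : ℝ) + 1 + (n + 1 / 2) = 3 * n + 3 / 2 := by ring
  have a4 : (2 * n : ℝ) + 1 + 1 + (n + 1 / 2) = 3 * n + 5 / 2 := by ring
  have hH : H2 (2 * n) = H2 (2 * n + 1) - 1 / (2 * (n : ℝ) + 1) ^ 2 := by
    rw [H2_succ]
    push_cast
    ring
  have hw : weight n = (-1) ^ n * ratioProd (2 * n) n * (5 / ((2 * n + 1) * (6 * n + 5))) := by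
    rw [ratioProd_diag]
    field_simp
  rw [show 2 * (n + 1) = 2 * n + 1 + 1 by ring, h4, summand, add_comm 1 (2 * n), hw, kernelTerm,
    antidiff, antidiff, H2_succ (2 * n + 1), hH, ratioProd_succ, ratioProd_succ]
  push_cast
  rw [a1, a2, a3, a4]
  field_simp
  ring

lemma summable_summand : Summable summand := by
  have hp : ∀ j : ℕ, Summable fun n : ℕ => (n : ℝ) ^ j * (16 / 27 : ℝ) ^ n := fun j =>
    summable_pow_mul_geometric_of_norm_lt_one j (by norm_num)
  refine Summable.of_norm_bounded (((hp 1).mul_left 42).add ((hp 0).mul_left 166)) fun k => ?_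
  have hk : (0 : ℝ) ≤ k := k.cast_nonneg
  have h1 : (21 + 22 * (k : ℝ)) / (1 + 2 * k) ≤ 21 := by
    rw [div_le_iff₀ (by positivity)]
    linarith
  have h2 : (145 + 174 * (k : ℝ)) / (1 + 2 * k) ^ 3 ≤ 145 := by
    rw [div_le_iff₀ (by positivity)]
    nlinarith [pow_nonneg hk 2, pow_nonneg hk 3]
  have h3 := H2_le (1 + 2 * k)
  have h4 := H2_nonneg (1 + 2 * k)
  have h5 : (21 + 22 * (k : ℝ)) / (1 + 2 * k) * H2 (1 + 2 * k) ≤ 21 * (1 + 2 * k) := by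
    push_cast at h3
    gcongr
  have h6 : 0 ≤ (21 + 22 * (k : ℝ)) / (1 + 2 * k) * H2 (1 + 2 * k) := by positivity
  have h7 : 0 ≤ (145 + 174 * (k : ℝ)) / (1 + 2 * k) ^ 3 := by positivity
  rw [summand, Real.norm_eq_abs, abs_mul, abs_of_nonneg (weight_nonneg k)]
  calc weight k * _ ≤ (16 / 27) ^ k * (42 * k + 166) := by
        refine mul_le_mul (weight_le k) ?_ (abs_nonneg _) (by positivity)
        rw [abs_le]
        constructor <;> linarith
    _ = _ := by ring

theorem stmt4 :
    (∑' k : ℕ, (16/27 : ℝ) ^ k * (poch 1 k ^ 2 / (poch (7/6) k * poch (11/6) k)) *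
      ((21 + 22 * (k : ℝ)) / (1 + 2 * (k : ℝ)) * H2 (1 + 2 * k) -
        (145 + 174 * (k : ℝ)) / (1 + 2 * (k : ℝ)) ^ 3)) = -120 * beta4 := by
  change ∑' k : ℕ, summand k = _
  refine tendsto_nhds_unique summable_summand.hasSum.tendsto_sum_nat ?_
  simp_rw [summand_eq_sub, Finset.sum_range_sub
    (fun n : ℕ => 15 / 2 * ((-1 : ℝ) ^ n * tailSum (2 * n) n))]
  convert (tendsto_tailSum_diag.const_mul (15 / 2)).sub_const _ using 2
  rw [mul_zero, pow_zero, mul_zero, tailSum_zero_zero]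
  ring
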